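/- (Landweber operator with adaptive step satisfies the stability assumption.) Let M > 0 and define T : ℝ^p → ℝ^p by T x = x − β(x)·Aᵀ(A x − b^δ) if Aᵀ(A x − b^δ) ≠ 0 and T x = x otherwise, where β(x) = min(‖A x − b^δ‖²/‖Aᵀ(A x − b^δ)‖², M). Then every x with Ax = b^δ is a fixed point of T, and for every x ∈ ℝ^p and every x̄ with A x̄ = b, ‖T x − x̄‖² ≤ ‖x − x̄‖² + M δ². -/

import Mathlib

open Matrix

/-- Matrix acting on a Euclidean vector. -/
noncomputable def mApp {m n : ℕ} (M : Matrix (Fin m) (Fin n) ℝ)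
    (x : EuclideanSpace ℝ (Fin n)) : EuclideanSpace ℝ (Fin m) :=
  Matrix.toEuclideanLin M x

theorem inner_mApp_transpose {m n : ℕ} (A : Matrix (Fin m) (Fin n) ℝ)
    (x : EuclideanSpace ℝ (Fin n)) (y : EuclideanSpace ℝ (Fin m)) :
    inner ℝ x (mApp Aᵀ y) = inner ℝ (mApp A x) y := by
  rw [mApp, mApp, ← Matrix.conjTranspose_eq_transpose_of_trivial,
    Matrix.toEuclideanLin_conjTranspose_eq_adjoint, LinearMap.adjoint_inner_right]

/-- A gradient step of length `β ≤ M` with `β ‖g‖² ≤ ‖r‖²` increases the squared distance to a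
point by at most `M ‖e‖²`, when `⟪u, g⟫ = ⟪r + e, r⟫` for the offset `u` from that point. -/
theorem norm_sub_smul_sq_le {E F : Type*} [NormedAddCommGroup E] [InnerProductSpace ℝ E]
    [NormedAddCommGroup F] [InnerProductSpace ℝ F] {u g : E} {r e : F} {β M : ℝ}
    (hβ : 0 ≤ β) (hβM : β ≤ M) (hg : β * ‖g‖ ^ 2 ≤ ‖r‖ ^ 2)
    (hinner : inner ℝ u g = inner ℝ (r + e) r) :
    ‖u - β • g‖ ^ 2 ≤ ‖u‖ ^ 2 + M * ‖e‖ ^ 2 := by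
  have hstep : ‖u - β • g‖ ^ 2 =
      ‖u‖ ^ 2 - 2 * (β * (‖r‖ ^ 2 + inner ℝ r e)) + β * (β * ‖g‖ ^ 2) := by
    rw [norm_sub_sq_real, inner_smul_right, hinner, inner_add_left, real_inner_self_eq_norm_sq,
      real_inner_comm, norm_smul, mul_pow, Real.norm_eq_abs, sq_abs]
    ring
  have hsum := norm_add_sq_real r e
  have hnonneg : 0 ≤ β * ‖r + e‖ ^ 2 := by positivity
  rw [hsum] at hnonneg
  have hmul := mul_le_mul_of_nonneg_left hg hβ
  have hM := mul_le_mul_of_nonneg_right hβM (sq_nonneg ‖e‖)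
  rw [hstep]
  linarith

/-- The Landweber operator with adaptive step
`β(x) = min(‖Ax − b^δ‖²/‖Aᵀ(Ax − b^δ)‖², M)` satisfies the stability assumption A3 with
`e_T = M`. -/
theorem adaptive_landweber_stability
    {p d : ℕ} (A : Matrix (Fin d) (Fin p) ℝ)
    (b bδ : EuclideanSpace ℝ (Fin d)) (δ : ℝ) (hδ : 0 ≤ δ) (hbδ : ‖bδ - b‖ ≤ δ)
    (M : ℝ) (hM : 0 < M)
    (T : EuclideanSpace ℝ (Fin p) → EuclideanSpace ℝ (Fin p))
    (hT1 : ∀ x, mApp Aᵀ (mApp A x - bδ) ≠ 0 →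
      T x = x - min (‖mApp A x - bδ‖ ^ 2 / ‖mApp Aᵀ (mApp A x - bδ)‖ ^ 2) M •
        mApp Aᵀ (mApp A x - bδ))
    (hT2 : ∀ x, mApp Aᵀ (mApp A x - bδ) = 0 → T x = x) :
    (∀ x : EuclideanSpace ℝ (Fin p), mApp A x = bδ → T x = x) ∧
    (∀ x xbar : EuclideanSpace ℝ (Fin p), mApp A xbar = b →
      ‖T x - xbar‖ ^ 2 ≤ ‖x - xbar‖ ^ 2 + M * δ ^ 2) := by
  refine ⟨fun x hx => hT2 x (by rw [hx, sub_self, mApp, map_zero]), fun x xbar hxbar => ?_⟩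
  by_cases hg : mApp Aᵀ (mApp A x - bδ) = 0
  · rw [hT2 x hg]
    have : 0 ≤ M * δ ^ 2 := by positivity
    linarith
  have hinner : inner ℝ (x - xbar) (mApp Aᵀ (mApp A x - bδ)) =
      inner ℝ (mApp A x - bδ + (bδ - b)) (mApp A x - bδ) := by
    have hsub : mApp A (x - xbar) = mApp A x - mApp A xbar :=
      map_sub (Matrix.toEuclideanLin A) x xbar
    rw [inner_mApp_transpose, hsub, hxbar, sub_add_sub_cancel]
  have hpos : 0 < ‖mApp Aᵀ (mApp A x - bδ)‖ ^ 2 := by positivity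
  rw [hT1 x hg, sub_right_comm]
  refine (norm_sub_smul_sq_le (le_min (by positivity) hM.le) (min_le_right _ _)
    ((le_div_iff₀ hpos).mp (min_le_left _ _)) hinner).trans ?_
  gcongr
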